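/- Let V be a finite nonempty set and let Φ^0, Φ^1 : V → V be fixed-point-free involutions. In the quotient space M = ([0,1] × V)/∼ (with (ε, v) ∼ (ε, Φ^ε(v)) for ε ∈ {0,1}), the number of connected components of M equals the number of orbits of the subgroup of permutations of V generated by Φ^0 and Φ^1. -/

import Mathlib

/-- The gluing relation on `[0,1] × V`: at an endpoint ε of the interval, `v`
is identified with `Φ^ε v`. -/
def glueRel {V : Type*} (Φ0 Φ1 : Equiv.Perm V) :
    (Set.Icc (0 : ℝ) 1) × V → (Set.Icc (0 : ℝ) 1) × V → Prop :=
  fun p q => p.1 = q.1 ∧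
    (((p.1 : ℝ) = 0 ∧ q.2 = Φ0 p.2) ∨ ((p.1 : ℝ) = 1 ∧ q.2 = Φ1 p.2))

/-- The quotient topology on the glued space (V discrete). -/
instance glueTop {V : Type*} (Φ0 Φ1 : Equiv.Perm V) :
    TopologicalSpace (Quot (glueRel Φ0 Φ1)) :=
  letI : TopologicalSpace V := ⊥
  TopologicalSpace.coinduced (Quot.mk _) inferInstance

section Gluing

variable {V : Type*} (Φ0 Φ1 : Equiv.Perm V)

/-- The orbits of the group generated by the two gluing permutations. -/
abbrev GlueOrbits : Type _ :=
  MulAction.orbitRel.Quotient (Subgroup.closure {Φ0, Φ1} : Subgroup (Equiv.Perm V)) V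

theorem glueOrbits_mk_eq {σ : Equiv.Perm V} (hσ : σ ∈ Subgroup.closure {Φ0, Φ1}) (v : V) :
    (Quotient.mk'' v : GlueOrbits Φ0 Φ1) = Quotient.mk'' (σ v) :=
  Quotient.sound' (Setoid.symm' _ ⟨⟨σ, hσ⟩, rfl⟩)

/-- The orbit of the interval through a point of the glued space. -/
def glueOrbit : Quot (glueRel Φ0 Φ1) → GlueOrbits Φ0 Φ1 :=
  Quot.lift (fun p => Quotient.mk'' p.2) <| by
    rintro p q ⟨-, ⟨-, h⟩ | ⟨-, h⟩⟩
    · rw [h]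
      exact glueOrbits_mk_eq Φ0 Φ1 (Subgroup.subset_closure (by simp)) _
    · rw [h]
      exact glueOrbits_mk_eq Φ0 Φ1 (Subgroup.subset_closure (by simp)) _

theorem continuous_glueOrbit [TopologicalSpace (GlueOrbits Φ0 Φ1)] :
    Continuous (glueOrbit Φ0 Φ1) := by
  let _ : TopologicalSpace V := ⊥
  have : DiscreteTopology V := ⟨rfl⟩
  refine continuous_coinduced_dom.2 ?_
  exact (continuous_of_discreteTopology (f := fun v : V =>
    (Quotient.mk'' v : GlueOrbits Φ0 Φ1))).comp continuous_snd

theorem continuous_glue_interval (v : V) :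
    Continuous fun t : Set.Icc (0 : ℝ) 1 => Quot.mk (glueRel Φ0 Φ1) (t, v) := by
  let _ : TopologicalSpace V := ⊥
  exact continuous_coinduced_rng.comp (Continuous.prodMk_left v)

/-- The connected component of the interval labelled by `v`. -/
def glueComponent (v : V) : ConnectedComponents (Quot (glueRel Φ0 Φ1)) :=
  ConnectedComponents.mk (Quot.mk _ (0, v))

theorem mk_eq_glueComponent (t : Set.Icc (0 : ℝ) 1) (v : V) :
    ConnectedComponents.mk (Quot.mk (glueRel Φ0 Φ1) (t, v)) = glueComponent Φ0 Φ1 v := by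
  refine ConnectedComponents.coe_eq_coe'.2 ?_
  exact (isPreconnected_range (continuous_glue_interval Φ0 Φ1 v)).subset_connectedComponent
    ⟨0, rfl⟩ ⟨t, rfl⟩

theorem glueComponent_apply_of_mem_closure {σ : Equiv.Perm V}
    (hσ : σ ∈ Subgroup.closure {Φ0, Φ1}) (v : V) :
    glueComponent Φ0 Φ1 (σ v) = glueComponent Φ0 Φ1 v := by
  induction hσ using Subgroup.closure_induction generalizing v with
  | mem σ hσ =>
    rcases hσ with rfl | rfl
    · exact congrArg ConnectedComponents.mk (Quot.sound ⟨rfl, .inl ⟨rfl, rfl⟩⟩).symm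
    · rw [← mk_eq_glueComponent Φ0 σ 1, ← mk_eq_glueComponent Φ0 σ 1]
      exact congrArg ConnectedComponents.mk (Quot.sound ⟨rfl, .inr ⟨rfl, rfl⟩⟩).symm
  | one => rfl
  | mul σ τ _ _ hσ hτ => exact (hσ (τ v)).trans (hτ v)
  | inv σ _ hσ => simpa using (hσ (σ⁻¹ v)).symm

/-- The connected components of the glued space correspond to the orbits. -/
def connectedComponentsEquivGlueOrbits :
    ConnectedComponents (Quot (glueRel Φ0 Φ1)) ≃ GlueOrbits Φ0 Φ1 :=
  letI : TopologicalSpace (GlueOrbits Φ0 Φ1) := ⊥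
  haveI : DiscreteTopology (GlueOrbits Φ0 Φ1) := ⟨rfl⟩
  { toFun := (continuous_glueOrbit Φ0 Φ1).connectedComponentsLift
    invFun := fun x => Quotient.liftOn' x (glueComponent Φ0 Φ1) <| by
      rintro _ v ⟨⟨σ, hσ⟩, rfl⟩
      exact glueComponent_apply_of_mem_closure Φ0 Φ1 hσ v
    left_inv := by
      intro x
      obtain ⟨⟨t, v⟩, rfl⟩ := ConnectedComponents.surjective_coe.comp Quot.mk_surjective x
      exact (mk_eq_glueComponent Φ0 Φ1 t v).symm
    right_inv := by
      intro x
      induction x using Quotient.inductionOn'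
      rfl }

end Gluing

/-- For fixed-point-free involutions Φ^0, Φ^1 of a finite nonempty
set V, the number of connected components of M = ([0,1] × V)/∼ equals the
number of orbits of the subgroup ⟨Φ^0, Φ^1⟩ ≤ Perm V acting on V. -/
theorem stmt_7 {V : Type*} [Fintype V] [Nonempty V] (Φ0 Φ1 : Equiv.Perm V)
    (h0inv : Function.Involutive Φ0) (h1inv : Function.Involutive Φ1)
    (h0 : ∀ v, Φ0 v ≠ v) (h1 : ∀ v, Φ1 v ≠ v) :
    Nat.card (ConnectedComponents (Quot (glueRel Φ0 Φ1))) =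
      Nat.card (MulAction.orbitRel.Quotient
        (Subgroup.closure {Φ0, Φ1} : Subgroup (Equiv.Perm V)) V) := by
  exact Nat.card_congr (connectedComponentsEquivGlueOrbits Φ0 Φ1)
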